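/- arXiv:2302.10858 — 12 statements merged into one kernel-verified Lean document; each statement's English description precedes it below -/
import Mathlib

section
/- For all natural numbers p and n, adding one positive vote strictly increases the pair of scores in the lexicographic order: (S(p, n), T(p, n)) < (S(p + 1, n), T(p + 1, n)) lexicographically. -/
/-- Raw score of Majority Judgement with three grades: `p` positive votes,
`n` negative votes. -/
def S (p n : ℕ) : ℤ := if p > n then (p : ℤ) else -(n : ℤ)

/-- Tie-breaking score, dual to the raw score. -/
def T (p n : ℕ) : ℤ := if p > n then -(n : ℤ) else (p : ℤ)

/-- Adding one positive vote strictly increases the score pair `(S, T)`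
in the lexicographic order. -/
theorem score_pair_strictMono_pos (p n : ℕ) :
    toLex (S p n, T p n) < toLex (S (p + 1) n, T (p + 1) n) := by
  rw [Prod.Lex.toLex_lt_toLex]
  simp only [S, T]
  split_ifs <;> omega
end

section
/- For all natural numbers p and n, adding one negative vote strictly decreases the pair of scores in the lexicographic order: (S(p, n + 1), T(p, n + 1)) < (S(p, n), T(p, n)) lexicographically. -/
/-- Adding one negative vote strictly decreases the score pair `(S, T)`
in the lexicographic order. -/
theorem score_pair_strictAnti_neg (p n : ℕ) :
    toLex (S p (n + 1), T p (n + 1)) < toLex (S p n, T p n) := by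
  rw [Prod.Lex.toLex_lt_toLex]
  unfold S T
  split_ifs <;> omega
end

section
/- For all natural numbers p₁, n₁, p₂, n₂, if the two part scores have the same weak sign, i.e. S(p₁, n₁) · S(p₂, n₂) ≥ 0, then the raw score is additive: S(p₁ + p₂, n₁ + n₂) = S(p₁, n₁) + S(p₂, n₂). -/
/-- If the raw scores of the two parts of the electorate have the same weak
sign, then the raw score is additive over the parts. -/
theorem score_add_of_sign_coherent (p₁ n₁ p₂ n₂ : ℕ)
    (h : S p₁ n₁ * S p₂ n₂ ≥ 0) :
    S (p₁ + p₂) (n₁ + n₂) = S p₁ n₁ + S p₂ n₂ := by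
  have zero_of_mixed {p n : ℕ} (hp : 0 < p) (h : 0 ≤ (p : ℤ) * -(n : ℤ)) : n = 0 := by
    have : 0 ≤ -(n : ℤ) := nonneg_of_mul_nonneg_right h (by exact_mod_cast hp)
    omega
  unfold S at *
  split_ifs at h with h₁ h₂ h₂
  · grind
  · have := zero_of_mixed (by omega) h
    grind
  · have := zero_of_mixed (by omega) ((mul_comm _ _).trans_ge h)
    grind
  · grind
end

section
/- For all natural numbers p₁, n₁, p₂, n₂, if the two part raw scores have the same weak sign, i.e. S(p₁, n₁) · S(p₂, n₂) ≥ 0, then the tie-breaking score is additive: T(p₁ + p₂, n₁ + n₂) = T(p₁, n₁) + T(p₂, n₂). -/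
/-- If the raw scores of the two parts of the electorate have the same weak
sign, then the tie-breaking score is additive over the parts. -/
theorem tieScore_add_of_sign_coherent (p₁ n₁ p₂ n₂ : ℕ)
    (h : S p₁ n₁ * S p₂ n₂ ≥ 0) :
    T (p₁ + p₂) (n₁ + n₂) = T p₁ n₁ + T p₂ n₂ := by
  unfold S at h
  unfold T
  split_ifs at h with h₁ h₂ h₂
  · rw [if_pos (by omega), if_pos h₁, if_pos h₂]
    push_cast
    ring
  · have hn : n₂ = 0 := by
      by_contra hne
      have hp : (0 : ℤ) < p₁ * n₂ := by
        exact_mod_cast Nat.mul_pos (by omega) (by omega)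
      linarith
    obtain rfl : p₂ = 0 := by omega
    simp [hn, h₁]
  · have hn : n₁ = 0 := by
      by_contra hne
      have hp : (0 : ℤ) < n₁ * p₂ := by
        exact_mod_cast Nat.mul_pos (by omega) (by omega)
      linarith
    obtain rfl : p₁ = 0 := by omega
    simp [hn, h₂]
  · rw [if_neg (by omega), if_neg h₁, if_neg h₂]
    push_cast
    ring
end

section
/- The pair of scores determines the vote counts: for all natural numbers p₁, n₁, p₂, n₂, if S(p₁, n₁) = S(p₂, n₂) and T(p₁, n₁) = T(p₂, n₂), then p₁ = p₂ and n₁ = n₂. Hence two candidates are tied under the score together with the tie-breaking score only if they have identical results. -/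
/-- The score together with the tie-breaking score determines the vote
counts: two candidates are tied only if they have identical results. -/
theorem counts_eq_of_scores_eq (p₁ n₁ p₂ n₂ : ℕ)
    (hS : S p₁ n₁ = S p₂ n₂) (hT : T p₁ n₁ = T p₂ n₂) :
    p₁ = p₂ ∧ n₁ = n₂ := by
  unfold S at hS
  unfold T at hT
  split_ifs at hS hT <;> omega
end

section
/- Absence of the No Show Paradox (strict case): let candidate A have counts (p_A, n_A) and candidate B have counts (p_B, n_B) with S(p_A, n_A) > S(p_B, n_B). If one additional ballot is added that assigns A a grade strictly greater than the grade it assigns B, then after updating both candidates' counts according to this ballot, the score of A is still strictly greater than the score of B. -/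
/-- The three grades of Majority Judgement, with `negative < neutral < positive`. -/
inductive Grade : Type
  | negative
  | neutral
  | positive
  deriving DecidableEq

/-- Numerical encoding of the grades, respecting their order. -/
def Grade.toNat : Grade → ℕ
  | .negative => 0
  | .neutral => 1
  | .positive => 2

instance : LinearOrder Grade :=
  LinearOrder.lift' Grade.toNat
    (by intro a b h; cases a <;> cases b <;> simp_all [Grade.toNat])

/-- Updating the vote counts `(p, n)` of a candidate by one additional ballot
assigning the grade `g` to that candidate. -/
def update (g : Grade) (pn : ℕ × ℕ) : ℕ × ℕ :=
  match g with
  | .positive => (pn.1 + 1, pn.2)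
  | .negative => (pn.1, pn.2 + 1)
  | .neutral => pn

theorem S_le_S_update {g : Grade} (h : g ≠ .negative) (p n : ℕ) :
    S p n ≤ S (update g (p, n)).1 (update g (p, n)).2 := by
  cases g with
  | negative => exact absurd rfl h
  | neutral => exact le_rfl
  | positive => simp only [S, update]; split_ifs <;> omega

theorem S_update_le_S {g : Grade} (h : g ≠ .positive) (p n : ℕ) :
    S (update g (p, n)).1 (update g (p, n)).2 ≤ S p n := by
  cases g with
  | negative => simp only [S, update]; split_ifs <;> omega
  | neutral => exact le_rfl
  | positive => exact absurd rfl h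

/-- Absence of the No Show Paradox, strict case: if A's score is strictly
greater than B's score and an additional ballot grades A strictly better
than B, then after the ballot A's score is still strictly greater. -/
theorem no_show_paradox_strict (pA nA pB nB : ℕ) (gA gB : Grade)
    (hS : S pA nA > S pB nB) (hg : gB < gA) :
    S (update gA (pA, nA)).1 (update gA (pA, nA)).2 >
      S (update gB (pB, nB)).1 (update gB (pB, nB)).2 := by
  have hA : gA ≠ .negative := by
    rintro rfl
    revert hg
    cases gB <;> decide
  have hB : gB ≠ .positive := by
    rintro rfl
    revert hg
    cases gA <;> decide
  exact (S_update_le_S hB pB nB).trans_lt (hS.trans_le (S_le_S_update hA pA nA))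
end

section
/- Weak consistency of Majority Judgement with three grades (zero-score case of Theorem 1): if candidate A strictly wins part 1 and strictly wins part 2, and S(p₁(A), n₁(A)) = S(p₂(A), n₂(A)) = 0, then A strictly wins the overall vote. -/
theorem S_eq_zero_iff {p n : ℕ} : S p n = 0 ↔ p = 0 ∧ n = 0 := by
  unfold S
  split_ifs <;> omega

theorem S_neg_iff {p n : ℕ} : S p n < 0 ↔ p ≤ n ∧ 0 < n := by
  unfold S
  split_ifs <;> omega

/-- Weak consistency of Majority Judgement with three grades, zero-score
case: if candidate `A` strictly wins both parts of the electorate and its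
score vanishes in both parts, then `A` strictly wins the overall vote. -/
theorem weak_consistency_zero {C : Type*} [Fintype C]
    (p₁ n₁ p₂ n₂ : C → ℕ) (A : C)
    (hwin1 : ∀ B : C, B ≠ A → S (p₁ A) (n₁ A) > S (p₁ B) (n₁ B))
    (hwin2 : ∀ B : C, B ≠ A → S (p₂ A) (n₂ A) > S (p₂ B) (n₂ B))
    (hz1 : S (p₁ A) (n₁ A) = 0) (hz2 : S (p₂ A) (n₂ A) = 0) :
    ∀ B : C, B ≠ A →
      S (p₁ A + p₂ A) (n₁ A + n₂ A) > S (p₁ B + p₂ B) (n₁ B + n₂ B) := by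
  intro B hB
  have hneg1 := hwin1 B hB
  have hneg2 := hwin2 B hB
  rw [hz1, gt_iff_lt, S_neg_iff] at hneg1
  rw [hz2, gt_iff_lt, S_neg_iff] at hneg2
  rw [S_eq_zero_iff] at hz1 hz2
  have hz : S (p₁ A + p₂ A) (n₁ A + n₂ A) = 0 := S_eq_zero_iff.2 (by omega)
  rw [hz, gt_iff_lt, S_neg_iff]
  omega
end

section
/- Weak consistency of Majority Judgement with three grades (negative-score case of Theorem 1): if candidate A strictly wins part 1 and strictly wins part 2, and S(p₁(A), n₁(A)) < 0 and S(p₂(A), n₂(A)) < 0, then A strictly wins the overall vote. -/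
/-- Weak consistency of Majority Judgement with three grades, negative-score
case: if candidate `A` strictly wins both parts of the electorate and its
score is negative in both parts, then `A` strictly wins the overall vote. -/
theorem weak_consistency_neg {C : Type*} [Fintype C]
    (p₁ n₁ p₂ n₂ : C → ℕ) (A : C)
    (hwin1 : ∀ B : C, B ≠ A → S (p₁ A) (n₁ A) > S (p₁ B) (n₁ B))
    (hwin2 : ∀ B : C, B ≠ A → S (p₂ A) (n₂ A) > S (p₂ B) (n₂ B))
    (hneg1 : S (p₁ A) (n₁ A) < 0) (hneg2 : S (p₂ A) (n₂ A) < 0) :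
    ∀ B : C, B ≠ A →
      S (p₁ A + p₂ A) (n₁ A + n₂ A) > S (p₁ B + p₂ B) (n₁ B + n₂ B) := by
  intro B hB
  have h1 := hwin1 B hB
  have h2 := hwin2 B hB
  unfold S at *
  split_ifs at * <;> omega
end

section
/- Weak consistency of Majority Judgement with three grades for sign-coherent partitions: suppose that for every candidate X the two part scores have the same weak sign, i.e. S(p₁(X), n₁(X)) · S(p₂(X), n₂(X)) ≥ 0. If candidate A strictly wins part 1 and strictly wins part 2, then A strictly wins the overall vote. -/
/-- The raw score is additive over two electorates whose scores have the same weak sign. -/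
theorem S_add_of_mul_nonneg {p n q m : ℕ} (h : 0 ≤ S p n * S q m) :
    S (p + q) (n + m) = S p n + S q m := by
  unfold S at *
  split_ifs at h ⊢ <;> first
    | (push_cast; omega)
    | (have hm : m = 0 := by
        by_contra hne
        have hp : (0 : ℤ) < p := by omega
        have hm : (0 : ℤ) < m := by omega
        nlinarith
       push_cast
       omega)
    | (have hn : n = 0 := by
        by_contra hne
        have hq : (0 : ℤ) < q := by omega
        have hn : (0 : ℤ) < n := by omega
        nlinarith
       push_cast
       omega)

/-- Weak consistency of Majority Judgement with three grades for
sign-coherent partitions of the electorate: if for every candidate the two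
part scores have the same weak sign and candidate `A` strictly wins both
parts, then `A` strictly wins the overall vote. -/
theorem weak_consistency_sign_coherent {C : Type*} [Fintype C]
    (p₁ n₁ p₂ n₂ : C → ℕ) (A : C)
    (hsign : ∀ X : C, S (p₁ X) (n₁ X) * S (p₂ X) (n₂ X) ≥ 0)
    (hwin1 : ∀ B : C, B ≠ A → S (p₁ A) (n₁ A) > S (p₁ B) (n₁ B))
    (hwin2 : ∀ B : C, B ≠ A → S (p₂ A) (n₂ A) > S (p₂ B) (n₂ B)) :
    ∀ B : C, B ≠ A →
      S (p₁ A + p₂ A) (n₁ A + n₂ A) > S (p₁ B + p₂ B) (n₁ B + n₂ B) := by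
  intro B hB
  rw [S_add_of_mul_nonneg (hsign A), S_add_of_mul_nonneg (hsign B)]
  exact add_lt_add (hwin1 B hB) (hwin2 B hB)
end

section
/- Consistency of the tie-breaking comparison for sign-coherent partitions: let A and B be candidates such that S(p₁(A), n₁(A)) · S(p₂(A), n₂(A)) ≥ 0 and S(p₁(B), n₁(B)) · S(p₂(B), n₂(B)) ≥ 0. If for each part i = 1, 2 the raw scores tie, S(pᵢ(A), nᵢ(A)) = S(pᵢ(B), nᵢ(B)), while A wins the tie break, T(pᵢ(A), nᵢ(A)) > T(pᵢ(B), nᵢ(B)), then overall S(p(A), n(A)) = S(p(B), n(B)) and T(p(A), n(A)) > T(p(B), n(B)). -/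
/-- Consistency of the tie-breaking comparison for sign-coherent partitions
of the electorate: if in both parts candidates `A` and `B` have tied raw
scores while `A` wins the tie break, and both candidates' part scores are
sign-coherent, then overall the raw scores tie and `A` wins the tie break. -/
theorem tie_break_consistency_sign_coherent {C : Type*} [Fintype C]
    (p₁ n₁ p₂ n₂ : C → ℕ) (A B : C)
    (hsignA : S (p₁ A) (n₁ A) * S (p₂ A) (n₂ A) ≥ 0)
    (hsignB : S (p₁ B) (n₁ B) * S (p₂ B) (n₂ B) ≥ 0)
    (hS1 : S (p₁ A) (n₁ A) = S (p₁ B) (n₁ B))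
    (hS2 : S (p₂ A) (n₂ A) = S (p₂ B) (n₂ B))
    (hT1 : T (p₁ A) (n₁ A) > T (p₁ B) (n₁ B))
    (hT2 : T (p₂ A) (n₂ A) > T (p₂ B) (n₂ B)) :
    S (p₁ A + p₂ A) (n₁ A + n₂ A) = S (p₁ B + p₂ B) (n₁ B + n₂ B) ∧
      T (p₁ A + p₂ A) (n₁ A + n₂ A) > T (p₁ B + p₂ B) (n₁ B + n₂ B) := by
  have hsign := mul_nonneg_iff.mp hsignA
  clear hsignA hsignB
  unfold S T at *
  grind
end

section
/- A grade better than the majority grade is rejected by at least half of the voters: for a nonempty finite multiset s of grades with N = card s and majority grade m, and for any grade g with g > m, twice the number of elements of s that are strictly less than g is at least N. -/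
/-- The majority grade of a nonempty multiset of grades: the entry at index
`⌊(N − 1)/2⌋` of the ascending sorted list (the lower median). -/
def majorityGrade {α : Type*} [LinearOrder α] (s : Multiset α) (hs : s ≠ 0) : α :=
  (s.sort (· ≤ ·)).get ⟨(Multiset.card s - 1) / 2, by
    rw [Multiset.length_sort]
    exact Nat.lt_of_le_of_lt (Nat.div_le_self _ _)
      (Nat.sub_lt (Multiset.card_pos.mpr hs) one_pos)⟩

/-- In a sorted list, if the entry at index `i` is below `g`, then at least `i + 1` entries are. -/
theorem List.Pairwise.succ_le_countP_lt {α : Type*} [LinearOrder α] {l : List α}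
    (hl : l.Pairwise (· ≤ ·)) {i : ℕ} (hi : i < l.length) {g : α} (hg : l[i] < g) :
    i + 1 ≤ l.countP (· < g) := by
  have hcount : (l.take (i + 1)).countP (· < g) = (l.take (i + 1)).length := by
    rw [List.countP_eq_length]
    intro a ha
    obtain ⟨j, hj, rfl⟩ := List.mem_iff_getElem.mp ha
    rw [List.length_take] at hj
    rw [List.getElem_take, decide_eq_true_iff]
    refine lt_of_le_of_lt ?_ hg
    rcases Nat.lt_or_ge j i with hji | hij
    · exact List.pairwise_iff_getElem.mp hl j i (by omega) hi hji
    · obtain rfl : j = i := by omega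
      exact le_rfl
  have hle := (List.take_sublist (i + 1) l).countP_le (p := (· < g))
  rw [hcount, List.length_take] at hle
  omega

/-- A grade better than the majority grade is rejected by at least half of
the voters: twice the number of grades strictly below `g` is at least the
total number of voters. -/
theorem half_reject_better_grade {α : Type*} [LinearOrder α]
    (s : Multiset α) (hs : s ≠ 0) (g : α) (hg : majorityGrade s hs < g) :
    Multiset.card s ≤ 2 * Multiset.card (s.filter (fun x => x < g)) := by
  have hcount := (s.pairwise_sort (· ≤ ·)).succ_le_countP_lt _ hg
  have heq : (s.sort (· ≤ ·)).countP (· < g) = Multiset.card (s.filter (fun x => x < g)) := by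
    rw [← Multiset.countP_eq_card_filter, ← Multiset.coe_countP, Multiset.sort_eq]
  omega
end

section
/- A grade worse than the majority grade is objected to by a strict majority of the voters: for a nonempty finite multiset s of grades with N = card s and majority grade m, and for any grade g with g < m, twice the number of elements of s that are strictly greater than g is strictly greater than N. -/
/-- In an ascending list, if the entry at index `i` is above `g`, then at least
`l.length - i` entries are above `g`. -/
theorem List.Pairwise.length_sub_le_length_filter_lt {α : Type*} [LinearOrder α] {l : List α}
    (hl : l.Pairwise (· ≤ ·)) {i : ℕ} (hi : i < l.length) {g : α} (hg : g < l[i]) :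
    l.length - i ≤ (l.filter (fun x => g < x)).length := by
  have h_drop : (l.drop i).filter (fun x => g < x) = l.drop i := by
    rw [List.filter_eq_self]
    intro x hx
    rw [List.drop_eq_getElem_cons hi] at hx
    have h_tail := hl.drop (i := i)
    rw [List.drop_eq_getElem_cons hi, List.pairwise_cons] at h_tail
    rcases List.mem_cons.mp hx with rfl | hx
    · simpa using hg
    · simpa using hg.trans_le (h_tail.1 x hx)
  rw [← List.length_drop, ← h_drop]
  exact ((List.drop_sublist i l).filter _).length_le

/-- A grade worse than the majority grade is objected to by a strict
majority of the voters: twice the number of grades strictly above `g` is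
strictly greater than the total number of voters. -/
theorem majority_object_worse_grade {α : Type*} [LinearOrder α]
    (s : Multiset α) (hs : s ≠ 0) (g : α) (hg : g < majorityGrade s hs) :
    Multiset.card s < 2 * Multiset.card (s.filter (fun x => g < x)) := by
  have h_count := (s.pairwise_sort (· ≤ ·)).length_sub_le_length_filter_lt
    (i := (Multiset.card s - 1) / 2) (g := g) _ hg
  have h_filter : Multiset.card (s.filter (fun x => g < x)) =
      ((s.sort (· ≤ ·)).filter (fun x => g < x)).length := by
    conv_lhs => rw [← s.sort_eq (· ≤ ·)]
    rw [Multiset.filter_coe, Multiset.coe_card]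
  rw [Multiset.length_sort] at h_count
  have h_pos := Multiset.card_pos.mpr hs
  omega
end
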